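/- arXiv:1605.02001 — 2 statements merged into one kernel-verified Lean document; each statement's English description precedes it below -/
import Mathlib

section
/- The graph C(D̃₅) (points {0,...,5}, lines {0,2},{1,2},{2,3},{3,4},{3,5}) has exactly 47 Veldkamp lines of size three. -/
open Finset

/-- A geometric hyperplane of a graph (point-line structure with lines of size two):
a proper subset `H` of the points such that every line either lies fully in `H`
or meets `H` in exactly one point. -/
def IsHyp {n : ℕ} (E : Finset (Finset (Fin n))) (H : Finset (Fin n)) : Prop :=
  H ≠ Finset.univ ∧ ∀ e ∈ E, e ⊆ H ∨ (e ∩ H).card = 1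

/-- A three-point Veldkamp line: an unordered triple of distinct geometric hyperplanes
whose third member is the complement of the symmetric difference of the other two. -/
def IsVLine {n : ℕ} (E : Finset (Finset (Fin n))) (T : Finset (Finset (Fin n))) : Prop :=
  ∃ H1 H2 H3 : Finset (Fin n), IsHyp E H1 ∧ IsHyp E H2 ∧ IsHyp E H3 ∧
    H1 ≠ H2 ∧ H1 ≠ H3 ∧ H2 ≠ H3 ∧ H3 = (symmDiff H1 H2)ᶜ ∧ T = {H1, H2, H3}
def edgesD5 : Finset (Finset (Fin 6)) := {{0,2},{1,2},{2,3},{3,4},{3,5}}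

instance IsHyp.decidable {n : ℕ} (E : Finset (Finset (Fin n))) (H : Finset (Fin n)) :
    Decidable (IsHyp E H) :=
  inferInstanceAs (Decidable (_ ∧ _))

/-- The triples `{H1, H2, H3}` as a finite image of pairs of hyperplanes. -/
def veldkampLines {n : ℕ} (E : Finset (Finset (Fin n))) : Finset (Finset (Finset (Fin n))) :=
  let hyps := (univ : Finset (Finset (Fin n))).filter (IsHyp E)
  ((hyps ×ˢ hyps).filter fun p => IsHyp E (symmDiff p.1 p.2)ᶜ ∧ p.1 ≠ p.2 ∧
    p.1 ≠ (symmDiff p.1 p.2)ᶜ ∧ p.2 ≠ (symmDiff p.1 p.2)ᶜ).image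
    fun p => {p.1, p.2, (symmDiff p.1 p.2)ᶜ}

theorem coe_veldkampLines {n : ℕ} (E : Finset (Finset (Fin n))) :
    (veldkampLines E : Set (Finset (Finset (Fin n)))) = {T | IsVLine E T} := by
  ext T
  simp only [veldkampLines, coe_image, Set.mem_image, mem_coe, mem_filter, mem_product, mem_univ,
    true_and, Prod.exists, Set.mem_ofPred_eq, IsVLine]
  constructor
  · rintro ⟨H1, H2, ⟨⟨h1, h2⟩, h3, h12, h13, h23⟩, rfl⟩
    exact ⟨H1, H2, _, h1, h2, h3, h12, h13, h23, rfl, rfl⟩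
  · rintro ⟨H1, H2, _, h1, h2, h3, h12, h13, h23, rfl, rfl⟩
    exact ⟨H1, H2, ⟨⟨h1, h2⟩, h3, h12, h13, h23⟩, rfl⟩

/-- The binary code of a finite set, given a numbering of its elements. -/
def binaryCode {α : Type*} (f : α → ℕ) (s : Finset α) : ℕ := ∑ a ∈ s, 2 ^ f a

theorem binaryCode_injective {α : Type*} {f : α → ℕ} (hf : Function.Injective f) :
    Function.Injective (binaryCode f) := by
  intro s t h
  have h' : ∑ i ∈ s.map ⟨f, hf⟩, 2 ^ i = ∑ i ∈ t.map ⟨f, hf⟩, 2 ^ i := by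
    simpa [binaryCode, sum_map] using h
  exact map_injective _ (geomSum_injective le_rfl h')

theorem card_veldkampLines_edgesD5 : (veldkampLines edgesD5).card = 47 := by
  rw [← card_image_of_injective _
    (binaryCode_injective (binaryCode_injective Fin.val_injective)), veldkampLines, image_image]
  decide +kernel

theorem stmt8 : {T : Finset (Finset (Fin 6)) | IsVLine edgesD5 T}.ncard = 47 := by
  rw [← coe_veldkampLines, Set.ncard_coe_finset, card_veldkampLines_edgesD5]
end

section
/- The graph C(D̃₈) with points {0,...,8} and lines {0,2},{1,2},{2,3},{3,4},{4,5},{5,6},{6,7},{6,8} has exactly 105 geometric hyperplanes and exactly 876 Veldkamp lines of size three. -/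
open Finset

def edgesD8 : Finset (Finset (Fin 9)) := {{0,2},{1,2},{2,3},{3,4},{4,5},{5,6},{6,7},{6,8}}

/-- The subset of `Fin n` whose complement has the binary expansion of `m` as its indicator. -/
def coBits (n m : ℕ) : Finset (Fin n) := Finset.univ.filter fun i => m.testBit i = false

lemma mem_coBits {n m : ℕ} {i : Fin n} : i ∈ coBits n m ↔ m.testBit i = false := by
  simp [coBits]

lemma coBits_xor (n a b : ℕ) : coBits n (a ^^^ b) = (symmDiff (coBits n a) (coBits n b))ᶜ := by
  ext i
  simp only [mem_compl, mem_symmDiff, mem_coBits, Nat.testBit_xor]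
  cases a.testBit i <;> cases b.testBit i <;> simp

lemma coBits_injOn (n : ℕ) : Set.InjOn (coBits n) (range (2 ^ n)) := by
  intro a ha b hb h
  rw [mem_coe, mem_range] at ha hb
  refine Nat.eq_of_testBit_eq fun i => ?_
  by_cases hi : i < n
  · have := Finset.ext_iff.mp h ⟨i, hi⟩
    simp only [mem_coBits] at this
    cases h1 : a.testBit i <;> cases h2 : b.testBit i <;> simp_all
  · have hle : 2 ^ n ≤ 2 ^ i := Nat.pow_le_pow_right two_pos (not_lt.mp hi)
    rw [Nat.testBit_lt_two_pow (ha.trans_le hle), Nat.testBit_lt_two_pow (hb.trans_le hle)]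

lemma exists_coBits_eq {n : ℕ} (H : Finset (Fin n)) : ∃ m < 2 ^ n, coBits n m = H := by
  have himage : (range (2 ^ n)).image (coBits n) = univ := by
    rw [← Finset.card_eq_iff_eq_univ, card_image_of_injOn (coBits_injOn n)]
    simp
  have hH := mem_univ H
  rw [← himage] at hH
  simpa using hH

/-- The codes `m < 2 ^ n` of the geometric hyperplanes of a graph with edge set `E`. -/
def hypCodes {n : ℕ} (E : Finset (Finset (Fin n))) : Finset ℕ :=
  (range (2 ^ n)).filter fun m =>
    coBits n m ≠ univ ∧ ∀ e ∈ E, e ⊆ coBits n m ∨ (e ∩ coBits n m).card = 1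

lemma mem_hypCodes {n : ℕ} {E : Finset (Finset (Fin n))} {m : ℕ} :
    m ∈ hypCodes E ↔ m < 2 ^ n ∧ IsHyp E (coBits n m) := by
  simp [hypCodes, IsHyp]

lemma ncard_isHyp {n : ℕ} (E : Finset (Finset (Fin n))) :
    {H : Finset (Fin n) | IsHyp E H}.ncard = (hypCodes E).card := by
  have himage : {H : Finset (Fin n) | IsHyp E H} = coBits n '' hypCodes E := by
    ext H
    obtain ⟨m, hm, rfl⟩ := exists_coBits_eq H
    simp only [Set.mem_ofPred_eq, Set.mem_image, mem_coe, mem_hypCodes]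
    exact ⟨fun h => ⟨m, ⟨hm, h⟩, rfl⟩, fun ⟨a, ha, hab⟩ => hab ▸ ha.2⟩
  rw [himage, ((coBits_injOn n).mono ?_).ncard_image, Set.ncard_coe_finset]
  exact fun m hm => by simpa using (mem_hypCodes.mp hm).1

/-- The triples `{a, b, a ^^^ b}` of elements of `S` with `a < b < a ^^^ b`,
represented by `(a, b)`. -/
def xorPairs (S : Finset ℕ) : Finset (Σ _ : ℕ, ℕ) :=
  S.sigma fun a => S.filter fun b => a < b ∧ b < a ^^^ b ∧ a ^^^ b ∈ S

lemma mem_xorPairs {S : Finset ℕ} {p : Σ _ : ℕ, ℕ} :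
    p ∈ xorPairs S ↔ p.1 ∈ S ∧ p.2 ∈ S ∧ p.1 < p.2 ∧ p.2 < p.1 ^^^ p.2 ∧ p.1 ^^^ p.2 ∈ S := by
  simp [xorPairs]

/-- The three-element set of codes represented by `p`. -/
def xorTriple (p : Σ _ : ℕ, ℕ) : Finset ℕ := {p.1, p.2, p.1 ^^^ p.2}

lemma xorTriple_subset {S : Finset ℕ} {p : Σ _ : ℕ, ℕ} (hp : p ∈ xorPairs S) :
    xorTriple p ⊆ S := by
  obtain ⟨h1, h2, -, -, h3⟩ := mem_xorPairs.mp hp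
  simp [xorTriple, insert_subset_iff, h1, h2, h3]

lemma xorTriple_injOn (S : Finset ℕ) : Set.InjOn xorTriple (xorPairs S) := by
  rintro ⟨a, b⟩ hp ⟨c, d⟩ hq h
  obtain ⟨-, -, hab, hb, -⟩ := mem_xorPairs.mp hp
  obtain ⟨-, -, hcd, hd, -⟩ := mem_xorPairs.mp hq
  simp only [xorTriple, Finset.ext_iff, mem_insert, mem_singleton] at *
  have ha := h a
  have hb' := h b
  have hc := h c
  have hd' := h d
  have hx := h (a ^^^ b)
  have hy := h (c ^^^ d)
  obtain ⟨rfl, rfl⟩ : a = c ∧ b = d := by omega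
  rfl

lemma exists_xorTriple_eq {S : Finset ℕ} {a b : ℕ} (ha : a ∈ S) (hb : b ∈ S) (hc : a ^^^ b ∈ S)
    (hab : a ≠ b) (hac : a ≠ a ^^^ b) (hbc : b ≠ a ^^^ b) :
    ∃ p ∈ xorPairs S, xorTriple p = {a, b, a ^^^ b} := by
  have h1 : b ^^^ a = a ^^^ b := Nat.xor_comm b a
  have h2 : a ^^^ (a ^^^ b) = b := by simp
  have h3 : (a ^^^ b) ^^^ a = b := by rw [Nat.xor_comm, h2]
  have h4 : (a ^^^ b) ^^^ b = a := by simp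
  have h5 : b ^^^ (a ^^^ b) = a := by rw [Nat.xor_comm, h4]
  have key : ∀ x y : ℕ, x ∈ S → y ∈ S → x ^^^ y ∈ S → x < y → y < x ^^^ y →
      ({x, y, x ^^^ y} : Finset ℕ) = {a, b, a ^^^ b} →
      ∃ p ∈ xorPairs S, xorTriple p = {a, b, a ^^^ b} := fun x y hx hy hxy h h' heq =>
    ⟨⟨x, y⟩, mem_xorPairs.mpr ⟨hx, hy, h, h', hxy⟩, heq⟩
  rcases lt_or_gt_of_ne hab with h | h <;> rcases lt_or_gt_of_ne hac with h' | h' <;>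
    rcases lt_or_gt_of_ne hbc with h'' | h''
  · exact key a b ha hb hc h h'' rfl
  · exact key a (a ^^^ b) ha hc (by rwa [h2]) h' (by rwa [h2]) (by rw [h2]; grind)
  · omega
  · exact key (a ^^^ b) a hc ha (by rwa [h3]) h' (by rwa [h3]) (by rw [h3]; grind)
  · exact key b a hb ha (by rwa [h1]) h (by rwa [h1]) (by rw [h1]; grind)
  · omega
  · exact key b (a ^^^ b) hb hc (by rwa [h5]) h'' (by rwa [h5]) (by rw [h5]; grind)
  · exact key (a ^^^ b) b hc hb (by rwa [h4]) h'' (by rwa [h4]) (by rw [h4]; grind)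

lemma ncard_isVLine {n : ℕ} (E : Finset (Finset (Fin n))) :
    {T : Finset (Finset (Fin n)) | IsVLine E T}.ncard = (xorPairs (hypCodes E)).card := by
  have hrange : (hypCodes E : Set ℕ) ⊆ range (2 ^ n) := fun m hm => by
    simpa using (mem_hypCodes.mp hm).1
  have himage : {T : Finset (Finset (Fin n)) | IsVLine E T} =
      (fun p => (xorTriple p).image (coBits n)) '' xorPairs (hypCodes E) := by
    ext T
    constructor
    · rintro ⟨H1, H2, H3, hH1, hH2, hH3, h12, h13, h23, rfl, rfl⟩
      obtain ⟨a, ha, rfl⟩ := exists_coBits_eq H1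
      obtain ⟨b, hb, rfl⟩ := exists_coBits_eq H2
      rw [← coBits_xor] at *
      obtain ⟨p, hp, hpT⟩ := exists_xorTriple_eq (mem_hypCodes.mpr ⟨ha, hH1⟩)
        (mem_hypCodes.mpr ⟨hb, hH2⟩) (mem_hypCodes.mpr ⟨Nat.xor_lt_two_pow ha hb, hH3⟩)
        (fun h => h12 (congrArg _ h)) (fun h => h13 (congrArg _ h)) (fun h => h23 (congrArg _ h))
      exact ⟨p, hp, by simp [hpT, image_insert]⟩
    · rintro ⟨⟨a, b⟩, hp, rfl⟩
      obtain ⟨ha, hb, hab, hbc, hc⟩ := mem_xorPairs.mp hp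
      dsimp only at ha hb hab hbc hc
      have hinj := (coBits_injOn n).mono hrange
      exact ⟨coBits n a, coBits n b, coBits n (a ^^^ b), (mem_hypCodes.mp ha).2,
        (mem_hypCodes.mp hb).2, (mem_hypCodes.mp hc).2, fun h => hab.ne (hinj ha hb h),
        fun h => (hab.trans hbc).ne (hinj ha hc h), fun h => hbc.ne (hinj hb hc h),
        coBits_xor n a b, by simp [xorTriple, image_insert]⟩
  rw [himage, Set.InjOn.ncard_image, Set.ncard_coe_finset]
  intro p hp q hq h
  refine xorTriple_injOn _ hp hq (coe_injective ?_)
  have h' : coBits n '' (xorTriple p : Set ℕ) = coBits n '' (xorTriple q : Set ℕ) := by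
    simpa using congrArg (fun s : Finset (Finset (Fin n)) => (s : Set (Finset (Fin n)))) h
  exact ((coBits_injOn n).image_eq_image_iff ((coe_subset.mpr (xorTriple_subset hp)).trans hrange)
    ((coe_subset.mpr (xorTriple_subset hq)).trans hrange)).mp h'

lemma card_xorPairs_toFinset {l : List ℕ} (hl : l.Nodup) {p : ℕ → Bool}
    (hp : ∀ m, m ∈ l ↔ p m) :
    (xorPairs l.toFinset).card =
      (l.map fun a => l.countP fun b =>
        Nat.blt a b && (Nat.blt b (a ^^^ b) && p (a ^^^ b))).sum := by
  rw [xorPairs, card_sigma, List.sum_toFinset _ hl]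
  refine congrArg List.sum (List.map_congr_left fun a _ => ?_)
  rw [List.countP_eq_length_filter, ← List.toFinset_card_of_nodup (hl.filter _),
    List.toFinset_filter]
  simp [hp, Nat.blt_eq]

lemma pair_subset_or_card_inter_eq_one {n m : ℕ} {i j : Fin n} (hij : i ≠ j) :
    ({i, j} ⊆ coBits n m ∨ (({i, j} : Finset (Fin n)) ∩ coBits n m).card = 1) ↔
      (m.testBit i && m.testBit j) = false := by
  cases hi : m.testBit i <;> cases hj : m.testBit j <;>
    simp [insert_subset_iff, Finset.insert_inter_of_mem,
      Finset.insert_inter_of_notMem, Finset.singleton_inter_of_mem,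
      Finset.singleton_inter_of_notMem, mem_coBits, hi, hj, hij]

/-- Whether `m` is the code of a nonempty independent set of the graph `C(D̃₈)`. -/
def isCodeD8 (m : ℕ) : Bool :=
  Nat.blt m 512 && Nat.blt 0 m &&
    [(0, 2), (1, 2), (2, 3), (3, 4), (4, 5), (5, 6), (6, 7), (6, 8)].all
      fun e : ℕ × ℕ => !(m.testBit e.1 && m.testBit e.2)

lemma coBits_eq_univ_iff {n m : ℕ} (hm : m < 2 ^ n) : coBits n m = univ ↔ m = 0 := by
  have hzero : coBits n 0 = univ := by simp [coBits]
  rw [← hzero]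
  exact (coBits_injOn n).eq_iff (by simpa using hm) (by simp)

/-- The codes of the nonempty independent sets of the graph `C(D̃₈)`. -/
def codesD8 : List ℕ := (List.range 512).filter isCodeD8

lemma nodup_codesD8 : codesD8.Nodup := List.nodup_range.filter _

lemma mem_codesD8 {m : ℕ} : m ∈ codesD8 ↔ isCodeD8 m := by
  simp +contextual [codesD8, isCodeD8, Nat.blt_eq]

lemma hypCodes_edgesD8 : hypCodes edgesD8 = codesD8.toFinset := by
  ext m
  rw [mem_hypCodes, List.mem_toFinset, mem_codesD8, IsHyp]
  simp only [isCodeD8, Bool.and_eq_true, Nat.blt_eq, Nat.pos_iff_ne_zero, and_assoc]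
  refine and_congr_right fun hm => ?_
  rw [Ne, coBits_eq_univ_iff hm]
  simp only [edgesD8, forall_mem_insert, mem_singleton, forall_eq]
  repeat rw [pair_subset_or_card_inter_eq_one (by decide)]
  simp only [List.all_cons, List.all_nil, Bool.and_eq_true, Bool.not_eq_true', and_true]
  rfl

theorem stmt16 :
    {H : Finset (Fin 9) | IsHyp edgesD8 H}.ncard = 105 ∧
    {T : Finset (Finset (Fin 9)) | IsVLine edgesD8 T}.ncard = 876 := by
  rw [ncard_isHyp, ncard_isVLine, hypCodes_edgesD8, List.toFinset_card_of_nodup nodup_codesD8,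
    card_xorPairs_toFinset nodup_codesD8 fun _ => mem_codesD8]
  decide +kernel
end
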